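/- Let K be a field of characteristic zero. For all integers n ≥ 1 and m ≥ 1 there exists a nonzero polynomial G in 4n variables over K such that for every tuple (v_1,…,v_n) of nonzero vectors in K^4 with G(v_1,…,v_n) ≠ 0, the ideal I = ⋂_{j=1}^n m_{v_j} of the corresponding simple points in P^3 satisfies α(I^{(m)}) ≥ (m/2)·n^{1/3}. In particular, the Waldschmidt constant of the ideal of n points in general position in P^3 satisfies γ(n) ≥ (1/2)·n^{1/3}. -/

import Mathlib

open MvPolynomial Filter

noncomputable section

/-- The ideal of a point of `ℙ³` represented by a nonzero vector `v ∈ K⁴`: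
the ideal generated by all linear forms vanishing at `v`. -/
def pointIdeal (K : Type) [Field K] (v : Fin 4 → K) : Ideal (MvPolynomial (Fin 4) K) :=
  Ideal.span {f | f.IsHomogeneous 1 ∧ eval v f = 0}

/-- `α(J)`: the least `t ≥ 0` such that the degree-`t` homogeneous component of the
homogeneous ideal `J` is nonzero. -/
def alphaDeg {K : Type} [Field K] {σ : Type} (J : Ideal (MvPolynomial σ K)) : ℕ :=
  sInf {t | ∃ f ∈ J, f ≠ 0 ∧ f.IsHomogeneous t}

/-- The translation `f(X) ↦ f(X + v)`. -/
def taylorShift {σ R : Type*} [CommRing R] (v : σ → R) : MvPolynomial σ R →ₐ[R] MvPolynomial σ R :=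
  aeval fun i => X i + C (v i)

section Translate

variable {σ R S : Type*} [CommRing R] [CommRing S]

lemma map_taylorShift (φ : R →+* S) (v : σ → R) (f : MvPolynomial σ R) :
    map φ (taylorShift v f) = taylorShift (φ ∘ v) (map φ f) := by
  induction f using MvPolynomial.induction_on with
  | C a => simp [taylorShift]
  | add p q hp hq => simp [hp, hq]
  | mul_X p i hp => simp [hp]; simp [taylorShift]

lemma constantCoeff_taylorShift (v : σ → R) (f : MvPolynomial σ R) :
    constantCoeff (taylorShift v f) = eval v f := by
  induction f using MvPolynomial.induction_on with
  | C a => simp [taylorShift]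
  | add p q hp hq => simp [hp, hq]
  | mul_X p i hp => simp [hp]; simp [taylorShift]

lemma finSuccEquiv_taylorShift {s : ℕ} (v : Fin (s + 1) → R) (f : MvPolynomial (Fin (s + 1)) R) :
    MvPolynomial.finSuccEquiv R s (taylorShift v f) =
      Polynomial.taylor (C (v 0))
        ((MvPolynomial.finSuccEquiv R s f).map (taylorShift (Fin.tail v)).toRingHom) := by
  induction f using MvPolynomial.induction_on with
  | C a => simp [taylorShift, finSuccEquiv_apply]
  | add p q hp hq => simp [hp, hq]
  | mul_X p i hp =>
    have hX : MvPolynomial.finSuccEquiv R s (taylorShift v (X i)) =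
        Polynomial.taylor (C (v 0))
          ((MvPolynomial.finSuccEquiv R s (X i)).map (taylorShift (Fin.tail v)).toRingHom) := by
      clear hp
      cases i using Fin.cases with
      | zero =>
        rw [finSuccEquiv_X_zero]
        simp [taylorShift, finSuccEquiv_apply]
      | succ j =>
        rw [finSuccEquiv_X_succ]
        simp [taylorShift, finSuccEquiv_apply, Fin.tail]
    rw [map_mul, map_mul, map_mul, hp, hX, Polynomial.map_mul, Polynomial.taylor_mul]

lemma coeff_coeff_taylor (α : σ →₀ ℕ) (b : R) (P : Polynomial (MvPolynomial σ R)) (j : ℕ) :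
    coeff α ((Polynomial.taylor (C b) P).coeff j) =
      (Polynomial.taylor b (∑ i ∈ P.support, Polynomial.monomial i (coeff α (P.coeff i)))).coeff
        j := by
  conv_lhs => rw [P.as_sum_support]
  simp only [map_sum, Polynomial.finsetSum_coeff, coeff_sum, Polynomial.taylor_monomial,
    Polynomial.coeff_C_mul, Polynomial.coeff_X_add_C_pow]
  refine Finset.sum_congr rfl fun i _ => ?_
  rw [← C_pow, ← map_natCast C, ← C_mul, mul_comm, coeff_C_mul, mul_comm]

end Translate

section Grid

variable {K : Type*} [Field K]

lemma Polynomial.exists_coeff_taylor_ne_zero {g : Polynomial K} (hg : g ≠ 0) {S : Finset K}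
    (hS : S.Nonempty) :
    ∃ b ∈ S, ∃ j, (Polynomial.taylor b g).coeff j ≠ 0 ∧ S.card * j ≤ g.natDegree := by
  classical
  have hsum : ∑ b ∈ S, g.rootMultiplicity b ≤ g.natDegree := by
    calc ∑ b ∈ S, g.rootMultiplicity b = ∑ b ∈ S, g.roots.count b := by simp
      _ ≤ ∑ b ∈ g.roots.toFinset, g.roots.count b :=
          Finset.sum_le_sum_of_ne_zero fun b _ hb => by
            simpa [Multiset.count_eq_zero, and_comm] using hb
      _ = Multiset.card g.roots := Multiset.toFinset_sum_count_eq _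
      _ ≤ g.natDegree := g.card_roots'
  obtain ⟨b, hb, hmin⟩ := S.exists_min_image (fun b => g.rootMultiplicity b) hS
  refine ⟨b, hb, g.rootMultiplicity b, ?_, ?_⟩
  · have hfac := g.pow_mul_divByMonic_rootMultiplicity_eq b
    apply_fun fun p => (Polynomial.taylor b p).coeff (g.rootMultiplicity b) at hfac
    rw [← hfac, Polynomial.taylor_mul, Polynomial.taylor_pow, map_sub, Polynomial.taylor_X,
      Polynomial.taylor_C, add_sub_cancel_right, Polynomial.coeff_X_pow_mul', if_pos le_rfl,
      Nat.sub_self, Polynomial.taylor_coeff_zero]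
    exact Polynomial.eval_divByMonic_pow_rootMultiplicity_ne_zero b hg
  · calc S.card * g.rootMultiplicity b ≤ ∑ b ∈ S, g.rootMultiplicity b := by
          simpa using S.card_nsmul_le_sum _ _ hmin
      _ ≤ _ := hsum

/-- A nonzero polynomial of degree `d` has multiplicity at most `d / |S|` at some point of the
grid `S^s`. -/
lemma exists_coeff_taylorShift_ne_zero {S : Finset K} (hS : S.Nonempty) {s : ℕ}
    (f : MvPolynomial (Fin s) K) (hf : f ≠ 0) :
    ∃ v : Fin s → K, (∀ i, v i ∈ S) ∧ ∃ β : Fin s →₀ ℕ,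
      coeff β (taylorShift v f) ≠ 0 ∧ S.card * β.degree ≤ f.totalDegree := by
  induction s with
  | zero =>
    refine ⟨Fin.elim0, fun i => i.elim0, 0, ?_, by simp⟩
    obtain ⟨a, rfl⟩ := C_surjective (Fin 0) f
    simpa [taylorShift] using hf
  | succ s ih =>
    set P := MvPolynomial.finSuccEquiv K s f with hP
    have hP0 : P ≠ 0 := by simpa [hP] using hf
    have hlead : P.coeff P.natDegree ≠ 0 := by simpa using hP0
    obtain ⟨a, ha, α, hα, hαd⟩ := ih _ hlead
    have hdeg : (P.coeff P.natDegree).totalDegree + P.natDegree ≤ f.totalDegree :=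
      totalDegree_coeff_finSuccEquiv_add_le f _ hlead
    set Q := P.map (taylorShift a).toRingHom with hQ
    set g : Polynomial K :=
      ∑ i ∈ Q.support, Polynomial.monomial i (coeff α (Q.coeff i)) with hg
    have hgc : ∀ i, g.coeff i = coeff α (Q.coeff i) := fun i => by
      simp +contextual [hg, Polynomial.finsetSum_coeff, Polynomial.coeff_monomial]
    have hg0 : g ≠ 0 := fun h => hα <| by
      have := hgc P.natDegree
      rw [h] at this
      simpa [hQ] using this.symm
    have hgd : g.natDegree ≤ P.natDegree := by
      refine Polynomial.natDegree_le_iff_coeff_eq_zero.2 fun i hi => ?_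
      simp [hgc, hQ, Polynomial.coeff_eq_zero_of_natDegree_lt hi]
    obtain ⟨b, hb, j, hj, hjd⟩ := Polynomial.exists_coeff_taylor_ne_zero hg0 hS
    refine ⟨Fin.cons b a, Fin.cases hb ha, α.cons j, ?_, ?_⟩
    · rw [← finSuccEquiv_coeff_coeff, finSuccEquiv_taylorShift, Fin.tail_cons, Fin.cons_zero,
        coeff_coeff_taylor]
      exact hj
    · have : (α.cons j).degree = j + α.degree := by
        simp [Finsupp.degree_eq_sum, Fin.sum_univ_succ]
      rw [this, mul_add]
      omega

lemma eval_smul_of_isHomogeneous {σ : Type*} {d : ℕ} {f : MvPolynomial σ K}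
    (hf : f.IsHomogeneous d) (c : K) (v : σ → K) : eval (c • v) f = c ^ d * eval v f := by
  rw [eval_eq, eval_eq, Finset.mul_sum]
  refine Finset.sum_congr rfl fun α hα => ?_
  have hd : ∑ i ∈ α.support, α i = d :=
    (hf.degree_eq_sum_deg_support hα).symm
  simp only [Pi.smul_apply, smul_eq_mul, mul_pow, Finset.prod_mul_distrib,
    Finset.prod_pow_eq_pow_sum, hd]
  ring

lemma totalDegree_aeval_le {σ τ : Type*} (p : σ → MvPolynomial τ K)
    (hp : ∀ i, (p i).totalDegree ≤ 1) (f : MvPolynomial σ K) :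
    (aeval p f).totalDegree ≤ f.totalDegree := by
  rw [aeval_def, eval₂_eq]
  refine totalDegree_finsetSum_le fun α hα => ?_
  calc _ ≤ (algebraMap K (MvPolynomial τ K) (coeff α f)).totalDegree +
        (∏ i ∈ α.support, p i ^ α i).totalDegree := totalDegree_mul _ _
    _ ≤ 0 + ∑ i ∈ α.support, α i := by
      refine add_le_add (by simp [algebraMap_eq]) ((totalDegree_finsetProd _ _).trans ?_)
      refine Finset.sum_le_sum fun i _ => (totalDegree_pow _ _).trans ?_
      simpa using Nat.mul_le_mul_left (α i) (hp i)
    _ ≤ f.totalDegree := by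
      rw [zero_add]
      exact le_totalDegree hα

lemma eq_zero_of_dehomogenize_eq_zero [Infinite K] {s d : ℕ} {f : MvPolynomial (Fin (s + 1)) K}
    (hf : f.IsHomogeneous d) (h : aeval (Fin.cons 1 X : Fin (s + 1) → MvPolynomial (Fin s) K) f = 0) :
    f = 0 := by
  have key : ∀ v : Fin (s + 1) → K, v 0 ≠ 0 → eval v f = 0 := fun v hv => by
    have hv1 : eval (Fin.cons 1 fun i : Fin s => v i.succ / v 0 : Fin (s + 1) → K) f = 0 := by
      rw [← map_zero (eval fun i : Fin s => v i.succ / v 0), ← h, aeval_def, ← coe_eval₂Hom,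
        ← RingHom.comp_apply]
      congr 1
      ext i
      · simp
      · refine Fin.cases ?_ (fun j => ?_) i <;> simp
    have hvs : v = v 0 • (Fin.cons 1 fun i : Fin s => v i.succ / v 0 : Fin (s + 1) → K) := by
      ext i
      refine Fin.cases ?_ (fun j => ?_) i
      · simp
      · simp [mul_div_cancel₀ _ hv]
    rw [hvs, eval_smul_of_isHomogeneous hf, hv1, mul_zero]
  have : X 0 * f = 0 := MvPolynomial.funext fun v => by
    by_cases hv : v 0 = 0
    · simp [hv]
    · simp [key v hv]
  simpa using this

lemma eq_zero_of_taylorShift_mem [Infinite K] {S : Finset K} {s d m : ℕ}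
    {f : MvPolynomial (Fin (s + 1)) K} (hf : f.IsHomogeneous d) (hd : d < S.card * m)
    (h : ∀ w : Fin s → K, (∀ i, w i ∈ S) →
      taylorShift (Fin.cons 1 w) f ∈ idealOfVars (Fin (s + 1)) K ^ m) :
    f = 0 := by
  by_contra hf0
  set g := aeval (Fin.cons 1 X : Fin (s + 1) → MvPolynomial (Fin s) K) f with hg
  have hg0 : g ≠ 0 := fun h => hf0 (eq_zero_of_dehomogenize_eq_zero hf h)
  have hgd : g.totalDegree ≤ d := by
    refine (totalDegree_aeval_le _ (fun i => ?_) f).trans hf.totalDegree_le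
    refine Fin.cases ?_ (fun j => ?_) i <;> simp
  have hS : S.Nonempty := by
    rw [← Finset.card_pos]
    exact Nat.pos_of_mul_pos_right (Nat.zero_lt_of_lt hd)
  obtain ⟨w, hw, β, hβ, hβd⟩ := exists_coeff_taylorShift_ne_zero hS g hg0
  have hcomp : taylorShift w g = aeval (Fin.cons 0 X : Fin (s + 1) → MvPolynomial (Fin s) K)
      (taylorShift (Fin.cons 1 w) f) := by
    rw [hg, ← AlgHom.comp_apply, ← AlgHom.comp_apply]
    congr 1
    ext i : 1
    refine Fin.cases ?_ (fun j => ?_) i <;> simp [taylorShift]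
  have hle : (idealOfVars (Fin (s + 1)) K).map
      (aeval (Fin.cons 0 X : Fin (s + 1) → MvPolynomial (Fin s) K)) ≤ idealOfVars (Fin s) K := by
    rw [idealOfVars, Ideal.map_span, Ideal.span_le]
    rintro _ ⟨_, ⟨i, rfl⟩, rfl⟩
    refine Fin.cases ?_ (fun j => ?_) i
    · simp
    · simpa using Ideal.subset_span (Set.mem_range_self j)
  have hmem : taylorShift w g ∈ idealOfVars (Fin s) K ^ m := by
    rw [hcomp]
    refine Ideal.pow_right_mono hle m ?_
    rw [← Ideal.map_pow]
    exact Ideal.mem_map_of_mem _ (h w hw)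
  refine hβ ((mem_pow_idealOfVars_iff' m _).1 hmem β ?_)
  by_contra! hcon
  have := Nat.mul_le_mul_left S.card hcon
  omega

end Grid

section Generic

variable {K : Type*} [Field K]

lemma exists_ne_zero_forall_mulVec_injective {ι κ σ : Type*} [Fintype ι] [Fintype κ]
    (M : Matrix ι κ (MvPolynomial σ K)) (v₀ : σ → K)
    (h : Function.Injective (M.map (eval v₀)).mulVec) :
    ∃ G : MvPolynomial σ K, G ≠ 0 ∧
      ∀ v, eval v G ≠ 0 → Function.Injective (M.map (eval v)).mulVec := by
  classical
  obtain ⟨L, hL⟩ := LinearMap.exists_leftInverse_of_injective (Matrix.toLin' (M.map (eval v₀)))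
    (LinearMap.ker_eq_bot.2 h)
  set A := LinearMap.toMatrix' L
  have hA : A * M.map (eval v₀) = 1 := by
    rw [← LinearMap.toMatrix'_toLin' (M.map (eval v₀)), ← LinearMap.toMatrix'_comp, hL,
      LinearMap.toMatrix'_id]
  have heval : ∀ v, eval v (A.map (C (σ := σ)) * M).det =
      (A * M.map (eval v) : Matrix κ κ K).det := fun v => by
    rw [RingHom.map_det, RingHom.mapMatrix_apply, Matrix.map_mul]
    congr 2
    ext i j
    simp
  refine ⟨(A.map (C (σ := σ)) * M).det, fun h0 => ?_, fun v hv => ?_⟩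
  · simpa [hA, h0] using heval v₀
  · rw [heval] at hv
    have := Matrix.mulVec_injective_of_det_ne_zero hv
    refine Function.Injective.of_comp (f := A.mulVec) ?_
    convert this using 1
    ext x : 1
    simp [Matrix.mulVec_mulVec]

lemma exists_ne_zero_forall_taylorShift {σ : Type*} [Finite σ] {n : ℕ} (d m : ℕ)
    (v₀ : Fin n → σ → K)
    (h : ∀ f : MvPolynomial σ K, f.IsHomogeneous d →
      (∀ j, taylorShift (v₀ j) f ∈ idealOfVars σ K ^ m) → f = 0) :
    ∃ G : MvPolynomial (Fin n × σ) K, G ≠ 0 ∧ ∀ v : Fin n → σ → K,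
      eval (fun p => v p.1 p.2) G ≠ 0 → ∀ f : MvPolynomial σ K, f.IsHomogeneous d →
        (∀ j, taylorShift (v j) f ∈ idealOfVars σ K ^ m) → f = 0 := by
  classical
  have : Fintype {α : σ →₀ ℕ // α.degree = d} :=
    (Finsupp.finite_of_degree_eq d).fintype
  have : Fintype {β : σ →₀ ℕ // β.degree < m} :=
    (Finsupp.finite_of_degree_lt m).fintype
  set M : Matrix (Fin n × {β : σ →₀ ℕ // β.degree < m}) {α : σ →₀ ℕ // α.degree = d}
      (MvPolynomial (Fin n × σ) K) :=
    .of fun p α => coeff p.2.1 (taylorShift (fun i => X (p.1, i)) (monomial α.1 1)) with hM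
  have hMv : ∀ (v : Fin n → σ → K) (c : {α : σ →₀ ℕ // α.degree = d} → K) p,
      (M.map (eval fun p => v p.1 p.2)).mulVec c p =
        coeff p.2.1 (taylorShift (v p.1) (∑ α, monomial α.1 (c α))) := fun v c p => by
    simp only [Matrix.mulVec, dotProduct, Matrix.map_apply, hM, Matrix.of_apply, map_sum,
      coeff_sum]
    refine Finset.sum_congr rfl fun α _ => ?_
    rw [← coeff_map, map_taylorShift]
    have : monomial α.1 (c α) = c α • monomial α.1 (1 : K) := by simp [smul_monomial]
    have hX : (eval fun p => v p.1 p.2) ∘ (fun i => X (p.1, i)) = v p.1 := by ext; simp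
    rw [this, map_smul, coeff_smul, smul_eq_mul, mul_comm, hX, map_monomial, map_one]
  obtain ⟨G, hG, hGv⟩ := exists_ne_zero_forall_mulVec_injective M (fun p => v₀ p.1 p.2) (by
    refine (injective_iff_map_eq_zero (Matrix.mulVecLin _)).2 fun c hc => ?_
    have hf := h (∑ α, monomial α.1 (c α))
      (IsHomogeneous.sum _ _ _ fun α _ => isHomogeneous_monomial _ α.2) fun j =>
        (mem_pow_idealOfVars_iff' m _).2 fun β hβ => by
          have hcβ := congrFun hc (j, ⟨β, hβ⟩)
          rwa [Matrix.mulVecLin_apply, hMv] at hcβ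
    ext α
    simpa [coeff_sum, coeff_monomial, Subtype.coe_inj] using congrArg (coeff α.1) hf)
  refine ⟨G, hG, fun v hv f hf hfv => ?_⟩
  have hfs : ∑ α : {α : σ →₀ ℕ // α.degree = d}, monomial α.1 (coeff α.1 f) = f := by
    ext β
    by_cases hβ : β.degree = d
    · rw [coeff_sum, Finset.sum_eq_single ⟨β, hβ⟩] <;>
        simp +contextual [coeff_monomial, Subtype.ext_iff]
    · rw [hf.coeff_eq_zero hβ, coeff_sum]
      refine Finset.sum_eq_zero fun α _ => ?_
      rw [coeff_monomial, if_neg]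
      rintro rfl
      exact hβ α.2
  have hc : (fun α : {α : σ →₀ ℕ // α.degree = d} => coeff α.1 f) = 0 := by
    refine hGv _ hv ?_
    simp only [Matrix.mulVec_zero]
    ext p
    rw [hMv, hfs]
    exact (mem_pow_idealOfVars_iff' m _).1 (hfv p.1) _ p.2.2
  rw [← hfs]
  exact Finset.sum_eq_zero fun α _ => by simpa using congrFun hc α

end Generic

lemma taylorShift_mem_of_mem_pointIdeal_pow {K : Type} [Field K] {v : Fin 4 → K} {m : ℕ}
    {f : MvPolynomial (Fin 4) K} (hf : f ∈ pointIdeal K v ^ m) :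
    taylorShift v f ∈ idealOfVars (Fin 4) K ^ m := by
  have hle : (pointIdeal K v).map (taylorShift v) ≤ idealOfVars (Fin 4) K := by
    rw [pointIdeal, Ideal.map_span, Ideal.span_le]
    rintro _ ⟨l, ⟨hl, hlv⟩, rfl⟩
    rw [SetLike.mem_coe, ← pow_one (idealOfVars _ _), mem_pow_idealOfVars_iff']
    intro β hβ
    obtain rfl : β = 0 := by simpa [Finsupp.degree_eq_zero_iff] using hβ
    rw [← constantCoeff_eq, ← hlv]
    exact constantCoeff_taylorShift v l
  refine Ideal.pow_right_mono hle m ?_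
  rw [← Ideal.map_pow]
  exact Ideal.mem_map_of_mem _ hf

lemma exists_isHomogeneous_one_eval_eq_zero {K : Type} [Field K] (v : Fin 4 → K) :
    ∃ l : MvPolynomial (Fin 4) K, l ≠ 0 ∧ l.IsHomogeneous 1 ∧ eval v l = 0 := by
  by_cases h : v 0 = 0
  · exact ⟨X 0, X_ne_zero _, isHomogeneous_X _ _, by simpa⟩
  · refine ⟨C (v 0) * X 1 - C (v 1) * X 0, fun h0 => h ?_, ?_, by simp; ring⟩
    · simpa [coeff_C_mul, coeff_X, Finsupp.single_left_inj] using
        congrArg (coeff (Finsupp.single 1 1)) h0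
    · exact ((isHomogeneous_X _ _).C_mul _).sub ((isHomogeneous_X _ _).C_mul _)

lemma exists_mem_isHomogeneous_alphaDeg {K : Type} [Field K] {n : ℕ} (v : Fin n → Fin 4 → K)
    (m : ℕ) :
    ∃ f ∈ ⨅ j, pointIdeal K (v j) ^ m, f ≠ 0 ∧
      f.IsHomogeneous (alphaDeg (⨅ j, pointIdeal K (v j) ^ m)) := by
  choose l hl0 hl hlv using fun j => exists_isHomogeneous_one_eval_eq_zero (v j)
  suffices h : {t | ∃ f ∈ ⨅ j, pointIdeal K (v j) ^ m, f ≠ 0 ∧ f.IsHomogeneous t}.Nonempty from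
    Nat.sInf_mem h
  refine ⟨_, ∏ j, l j ^ m, ?_, Finset.prod_ne_zero_iff.2 fun j _ => pow_ne_zero _ (hl0 j),
    IsHomogeneous.prod _ _ _ fun j _ => (hl j).pow m⟩
  have hlI : ∀ j, l j ∈ pointIdeal K (v j) := fun j => Ideal.subset_span ⟨hl j, hlv j⟩
  rw [Submodule.mem_iInf]
  exact fun j => Ideal.mem_of_dvd _ (Finset.dvd_prod_of_mem _ (Finset.mem_univ j))
    (Ideal.pow_mem_pow (hlI j) m)

lemma exists_pow_three_le_and_rpow_le {n : ℕ} (hn : 1 ≤ n) :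
    ∃ k : ℕ, k ^ 3 ≤ n ∧ (n : ℝ) ^ ((1 : ℝ) / 3) ≤ 2 * k := by
  set x := (n : ℝ) ^ ((1 : ℝ) / 3) with hx
  have hx1 : 1 ≤ x := Real.one_le_rpow (by exact_mod_cast hn) (by norm_num)
  have hx3 : x ^ 3 = n := by
    rw [hx, ← Real.rpow_natCast, ← Real.rpow_mul (by positivity)]
    norm_num
  refine ⟨⌊x⌋₊, ?_, ?_⟩
  · have : ((⌊x⌋₊ : ℕ) : ℝ) ^ 3 ≤ n := by
      rw [← hx3]
      exact pow_le_pow_left₀ (by positivity) (Nat.floor_le (by positivity)) 3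
    exact_mod_cast this
  · have h1 : (1 : ℝ) ≤ ⌊x⌋₊ := by exact_mod_cast Nat.le_floor (by exact_mod_cast hx1)
    linarith [Nat.lt_floor_add_one x]

/-- A form of degree `d < k * m` cannot vanish to order `m` at `n ≥ k ^ 3` general points. -/
lemma exists_ne_zero_forall_mul_le_alphaDeg (K : Type) [Field K] [CharZero K] {n k : ℕ} (m : ℕ)
    (hk : k ^ 3 ≤ n) :
    ∃ G : MvPolynomial (Fin n × Fin 4) K, G ≠ 0 ∧ ∀ v : Fin n → Fin 4 → K,
      eval (fun p => v p.1 p.2) G ≠ 0 →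
        k * m ≤ alphaDeg (⨅ j, pointIdeal K (v j) ^ m) := by
  set S : Finset K := (Finset.range k).map Nat.castEmbedding with hS
  have hcard : S.card = k := by simp [hS]
  obtain ⟨w, hw⟩ : ∃ w : Fin n → Fin 3 → K,
      ∀ u : Fin 3 → K, (∀ i, u i ∈ S) → ∃ j, w j = u := by
    obtain ⟨e⟩ : Nonempty ((Fin 3 → S) ↪ Fin n) :=
      Function.Embedding.nonempty_of_card_le (by simpa [hcard] using hk)
    refine ⟨Function.extend e (fun u i => (u i : K)) 0, fun u hu => ⟨e fun i => ⟨u i, hu i⟩, ?_⟩⟩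
    rw [e.injective.extend_apply]
  choose G hG0 hG using fun d : Fin (k * m) =>
    exists_ne_zero_forall_taylorShift d m (fun j => (Fin.cons 1 (w j) : Fin 4 → K))
      fun f hf hfw => eq_zero_of_taylorShift_mem (S := S) hf (by rw [hcard]; exact d.2)
        fun u hu => by
          obtain ⟨j, rfl⟩ := hw u hu
          exact hfw j
  refine ⟨∏ d, G d, Finset.prod_ne_zero_iff.2 fun d _ => hG0 d, fun v hv => ?_⟩
  rw [map_prod, Finset.prod_ne_zero_iff] at hv
  by_contra! hlt
  obtain ⟨f, hfI, hf0, hf⟩ := exists_mem_isHomogeneous_alphaDeg v m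
  refine hf0 (hG ⟨_, hlt⟩ v (hv _ (Finset.mem_univ _)) f hf fun j => ?_)
  exact taylorShift_mem_of_mem_pointIdeal_pow ((Submodule.mem_iInf _).1 hfI j)

/-- For `n` points in general position in `ℙ³`: `α(I^(m)) ≥ (m/2)·n^(1/3)`; in
particular the Waldschmidt constant satisfies `γ(n) ≥ (1/2)·n^(1/3)`. -/
theorem cube_root_lower_bound (K : Type) [Field K] [CharZero K] :
    (∀ n m : ℕ, 1 ≤ n → 1 ≤ m →
      ∃ G : MvPolynomial (Fin n × Fin 4) K, G ≠ 0 ∧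
        ∀ v : Fin n → Fin 4 → K, (∀ j, v j ≠ 0) →
          eval (fun p => v p.1 p.2) G ≠ 0 →
          (m : ℝ) / 2 * (n : ℝ) ^ ((1 : ℝ) / 3) ≤
            alphaDeg (⨅ j, pointIdeal K (v j) ^ m)) ∧
    (∀ n : ℕ, 1 ≤ n → ∀ v : Fin n → Fin 4 → K, (∀ j, v j ≠ 0) →
      (∀ m : ℕ, 1 ≤ m →
        (m : ℝ) / 2 * (n : ℝ) ^ ((1 : ℝ) / 3) ≤
          alphaDeg (⨅ j, pointIdeal K (v j) ^ m)) →
      ∀ γ : ℝ,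
        Tendsto (fun k : ℕ => (alphaDeg (⨅ j, pointIdeal K (v j) ^ k) : ℝ) / k)
          atTop (nhds γ) →
        (1 : ℝ) / 2 * (n : ℝ) ^ ((1 : ℝ) / 3) ≤ γ) := by
  refine ⟨fun n m hn _ => ?_, fun n _ v _ hv γ hγ => ?_⟩
  · obtain ⟨k, hk, hkr⟩ := exists_pow_three_le_and_rpow_le hn
    obtain ⟨G, hG0, hG⟩ := exists_ne_zero_forall_mul_le_alphaDeg K m hk
    refine ⟨G, hG0, fun v _ hGv => ?_⟩
    calc (m : ℝ) / 2 * (n : ℝ) ^ ((1 : ℝ) / 3) ≤ m / 2 * (2 * k) := by gcongr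
      _ = (k * m : ℕ) := by push_cast; ring
      _ ≤ _ := by exact_mod_cast hG v hGv
  · refine ge_of_tendsto hγ ((eventually_ge_atTop 1).mono fun m hm => ?_)
    have hm0 : (0 : ℝ) < m := by exact_mod_cast hm
    rw [le_div_iff₀ hm0]
    linarith [hv m hm]

end
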